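/- Let V be a Gödel set whose perfect kernel P is nonempty, and let W = V ∪ [inf P, 1]. Then the Gödel logics induced by V and W coincide: G_V = G_W. -/

import Mathlib

open Set

/-- Formulas of a relational first-order language with countably many predicate
symbols (symbol `p` has arity `ar p`); variables are de Bruijn indices. -/
inductive GFormula (ar : ℕ → ℕ) : Type
  | bot : GFormula ar
  | atom (p : ℕ) (ts : Fin (ar p) → ℕ) : GFormula ar
  | conj : GFormula ar → GFormula ar → GFormula ar
  | disj : GFormula ar → GFormula ar → GFormula ar
  | imp : GFormula ar → GFormula ar → GFormula ar
  | all : GFormula ar → GFormula ar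
  | ex : GFormula ar → GFormula ar

/-- All free variables of the formula are `< k`. -/
def GFormula.VarsBelow {ar : ℕ → ℕ} : ℕ → GFormula ar → Prop
  | _, .bot => True
  | k, .atom _ ts => ∀ i, ts i < k
  | k, .conj φ ψ => φ.VarsBelow k ∧ ψ.VarsBelow k
  | k, .disj φ ψ => φ.VarsBelow k ∧ ψ.VarsBelow k
  | k, .imp φ ψ => φ.VarsBelow k ∧ ψ.VarsBelow k
  | k, .all φ => φ.VarsBelow (k+1)
  | k, .ex φ => φ.VarsBelow (k+1)

/-- A closed formula (sentence). -/
def GFormula.IsClosedF {ar : ℕ → ℕ} (φ : GFormula ar) : Prop := φ.VarsBelow 0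

/-- The syntactic subformulas of a formula. -/
def GFormula.Subfs {ar : ℕ → ℕ} : GFormula ar → Set (GFormula ar)
  | .bot => {.bot}
  | .atom p ts => {.atom p ts}
  | .conj φ ψ => insert (.conj φ ψ) (φ.Subfs ∪ ψ.Subfs)
  | .disj φ ψ => insert (.disj φ ψ) (φ.Subfs ∪ ψ.Subfs)
  | .imp φ ψ => insert (.imp φ ψ) (φ.Subfs ∪ ψ.Subfs)
  | .all φ => insert (.all φ) φ.Subfs
  | .ex φ => insert (.ex φ) φ.Subfs

/-- A Gödel set: a closed subset of `[0,1]` containing `0` and `1`. -/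
def GodelSet (V : Set ℝ) : Prop :=
  IsClosed V ∧ V ⊆ Set.Icc (0:ℝ) 1 ∧ (0:ℝ) ∈ V ∧ (1:ℝ) ∈ V

/-- A valuation into `V`: a nonempty universe `M` together with interpretations of
all predicate symbols, taking values in `V`. -/
structure GValuation (ar : ℕ → ℕ) (V : Set ℝ) where
  M : Type
  ne : Nonempty M
  interp : ∀ p : ℕ, (Fin (ar p) → M) → ℝ
  interp_mem : ∀ p t, interp p t ∈ V

/-- Prepend a value to an environment. -/
def consEnv {M : Type} (m : M) (e : ℕ → M) : ℕ → M
  | 0 => m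
  | n+1 => e n

/-- The Gödel value of a formula under a valuation and an environment. -/
noncomputable def geval {ar : ℕ → ℕ} {V : Set ℝ} (v : GValuation ar V) :
    (ℕ → v.M) → GFormula ar → ℝ
  | _, .bot => 0
  | e, .atom p ts => v.interp p (fun i => e (ts i))
  | e, .conj φ ψ => min (geval v e φ) (geval v e ψ)
  | e, .disj φ ψ => max (geval v e φ) (geval v e ψ)
  | e, .imp φ ψ => if geval v e φ ≤ geval v e ψ then 1 else geval v e ψ
  | e, .all φ => sInf (Set.range fun m : v.M => geval v (consEnv m e) φ)
  | e, .ex φ => sSup (Set.range fun m : v.M => geval v (consEnv m e) φ)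

/-- The value `v(φ)` of a closed formula. -/
noncomputable def GValuation.val {ar : ℕ → ℕ} {V : Set ℝ}
    (v : GValuation ar V) (φ : GFormula ar) : ℝ :=
  geval v (fun _ => Classical.choice v.ne) φ

/-- `‖φ‖_V`: the infimum of `v(φ)` over all valuations `v` into `V`. -/
noncomputable def GNorm (ar : ℕ → ℕ) (V : Set ℝ) (φ : GFormula ar) : ℝ :=
  sInf (Set.range fun v : GValuation ar V => v.val φ)

/-- The Gödel logic of `V`: all closed formulas with `‖φ‖_V = 1`. -/
def GLogic (ar : ℕ → ℕ) (V : Set ℝ) : Set (GFormula ar) :=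
  {φ | φ.IsClosedF ∧ GNorm ar V φ = 1}

/-- The perfect kernel of a set of reals: the union of all its perfect subsets. -/
def perfectKernel (V : Set ℝ) : Set ℝ := ⋃₀ {P : Set ℝ | Perfect P ∧ P ⊆ V}

open MeasureTheory Filter Topology

theorem Perfect.not_countable_of_nonempty {C : Set ℝ} (hC : Perfect C) (hne : C.Nonempty) :
    ¬ C.Countable := by
  obtain ⟨f, hf, -, hinj⟩ := hC.exists_nat_bool_injection hne
  intro h
  have : (univ : Set (ℕ → Bool)).Countable :=
    MapsTo.countable_of_injOn (fun x _ => hf (mem_range_self x)) hinj.injOn h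
  rw [countable_univ_iff, ← Cardinal.mk_le_aleph0_iff] at this
  simp at this
  exact absurd this (not_le.2 Cardinal.aleph0_lt_continuum)

theorem exists_probabilityMeasure_nullSingletonClass {C : Set ℝ} (hC : MeasurableSet C)
    (hunc : ¬ C.Countable) :
    ∃ μ : Measure ℝ, IsProbabilityMeasure μ ∧ NullSingletonClass μ ∧ μ Cᶜ = 0 := by
  have := hC.standardBorel
  let e : ℝ ≃ᵐ C := PolishSpace.measurableEquivOfNotCountable
    (by rw [not_countable_iff]; infer_instance) (by rwa [Set.countable_coe_iff])
  have hm : Measurable fun x => (e x : ℝ) := measurable_subtype_coe.comp e.measurable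
  let ν : Measure ℝ := volume.restrict (Icc 0 1)
  have hν : IsProbabilityMeasure ν := ⟨by simp [ν]⟩
  refine ⟨ν.map fun x => (e x : ℝ), Measure.isProbabilityMeasure_map hm.aemeasurable,
    ⟨fun x => ?_⟩, ?_⟩
  · rw [Measure.map_apply hm (measurableSet_singleton x)]
    refine Set.Subsingleton.measure_zero ?_ ν
    intro a ha b hb
    simp only [mem_preimage, mem_singleton_iff] at ha hb
    exact e.injective (Subtype.ext (ha.trans hb.symm))
  · rw [Measure.map_apply hm hC.compl]
    convert measure_empty (μ := ν)
    ext x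
    simp

theorem exists_finiteMeasure_pos_Icc {C : Set ℝ} (hC : IsClosed C) {p : ℝ}
    (hunc : ∀ ε > 0, ¬ (C ∩ Icc p (p + ε)).Countable) :
    ∃ μ : Measure ℝ, IsFiniteMeasure μ ∧ NullSingletonClass μ ∧ μ (C ∩ Ici p)ᶜ = 0 ∧
      ∀ ε > 0, μ (Icc p (p + ε)) ≠ 0 := by
  choose μ hμ hatom hsupp using fun n : ℕ =>
    exists_probabilityMeasure_nullSingletonClass (hC.inter isClosed_Icc).measurableSet
      (hunc (1 / (n + 1 : ℝ)) (by positivity))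
  refine ⟨Measure.sum fun n => (2⁻¹ : ENNReal) ^ n • μ n, ⟨?_⟩, ⟨fun x => ?_⟩, ?_, fun ε hε => ?_⟩
  · simp [Measure.sum_apply _ MeasurableSet.univ, ENNReal.tsum_geometric]
  · simp [Measure.sum_apply _ (measurableSet_singleton x)]
  · have h0 : ∀ n, μ n (C ∩ Ici p)ᶜ = 0 := fun n =>
      measure_mono_null (compl_subset_compl.2 (inter_subset_inter_right _ Icc_subset_Ici_self))
        (hsupp n)
    simp [Measure.sum_apply _ (hC.inter isClosed_Ici).measurableSet.compl, h0]
  · obtain ⟨n, hn⟩ := exists_nat_one_div_lt hε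
    have h1 : μ n (Icc p (p + ε)) ≠ 0 := by
      intro h0
      have hu : μ n univ = 0 := by
        refine measure_mono_null (t := Icc p (p + ε) ∪ (C ∩ Icc p (p + 1 / (n + 1 : ℝ)))ᶜ)
          (fun x _ => ?_) (measure_union_null h0 (hsupp n))
        by_cases hx : x ∈ C ∩ Icc p (p + 1 / (n + 1 : ℝ))
        · exact Or.inl ⟨hx.2.1, hx.2.2.trans (by linarith)⟩
        · exact Or.inr hx
      simp at hu
    rw [Measure.sum_apply _ measurableSet_Icc]
    intro h
    rw [ENNReal.tsum_eq_zero] at h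
    have := h n
    simp [h1] at this

theorem continuous_measureReal_Iic (μ : Measure ℝ) [IsFiniteMeasure μ] [NullSingletonClass μ] :
    Continuous fun x => μ.real (Iic x) := by
  rw [continuous_iff_continuousAt]
  intro x
  have h := IntegrableOn.continuousOn_Iic_primitive_Iic (μ := μ) (f := fun _ => (1 : ℝ))
    (a₀ := x + 1) (by simp)
  simpa using h.continuousAt (Iic_mem_nhds (by linarith))

/-- A strictly monotone inverse of a continuous distribution function concentrated on `V`. -/
theorem exists_strictMono_quantile {V : Set ℝ} (hV : IsClosed V) {p : ℝ}
    (hunc : ∀ ε > 0, ¬ (V ∩ Icc p (p + ε)).Countable) {b : ℝ} (hb : ∀ x ∈ V, x ≤ b) :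
    ∃ (Q : ℝ → ℝ) (a : ℝ), StrictMono Q ∧ 0 < a ∧ Q a ≤ b ∧ (∀ y ≤ 0, Q y = p + y) ∧
      (∀ y, 0 < y → y < a → Q y ∈ V) ∧ ContinuousAt Q 0 := by
  obtain ⟨μ, hfin, hatom, hsupp, hpos⟩ := exists_finiteMeasure_pos_Icc hV hunc
  have hpb : p ≤ b := by
    have : (V ∩ Icc p (p + 1)).Nonempty := by
      by_contra h
      rw [not_nonempty_iff_eq_empty] at h
      exact hunc 1 one_pos (h ▸ countable_empty)
    obtain ⟨x, hxV, hx⟩ := this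
    exact hx.1.trans (hb x hxV)
  let F : ℝ → ℝ := fun x => μ.real (Iic x) + min (x - p) 0 + max (x - b) 0
  have hcont : Continuous F :=
    ((continuous_measureReal_Iic μ).add (by fun_prop)).add (by fun_prop)
  have hG : Monotone fun x => μ.real (Iic x) := fun x y h =>
    measureReal_mono (Iic_subset_Iic.2 h)
  have hmono : Monotone F := fun x y h => by
    have h1 : min (x - p) 0 ≤ min (y - p) 0 := min_le_min_right _ (by linarith)
    have h2 : max (x - b) 0 ≤ max (y - b) 0 := max_le_max_right _ (by linarith)
    exact add_le_add (add_le_add (hG h) h1) h2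
  have hlow : ∀ x ≤ p, F x = x - p := fun x hx => by
    have h0 : μ (Iic x) = 0 := by
      have : Iic x ⊆ {x} ∪ (V ∩ Ici p)ᶜ := fun z hz => by
        rcases (show z ≤ x from hz).eq_or_lt with rfl | h
        · exact Or.inl rfl
        · exact Or.inr fun hz' => absurd (show p ≤ z from hz'.2) (by linarith)
      exact measure_mono_null this (measure_union_null (measure_singleton x) hsupp)
    simp [F, measureReal_def, h0, min_eq_left (sub_nonpos.2 hx),
      max_eq_right (sub_nonpos.2 (hx.trans hpb))]
  have hFpos : ∀ x, p < x → 0 < F x := fun x hx => by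
    have h1 : 0 < μ.real (Iic x) := by
      rw [measureReal_def, ENNReal.toReal_pos_iff]
      refine ⟨pos_iff_ne_zero.2 fun h => hpos (x - p) (by linarith) ?_, measure_lt_top _ _⟩
      exact measure_mono_null (fun z hz => by have := hz.2; simp at this ⊢; linarith) h
    have h2 : 0 ≤ min (x - p) 0 := le_min (by linarith) le_rfl
    have h3 : 0 ≤ max (x - b) 0 := le_max_right _ _
    simp only [F]; linarith
  have hS : ∀ y, IsClosed {x | y ≤ F x} := fun y => isClosed_le continuous_const hcont
  have hSne : ∀ y, {x | y ≤ F x}.Nonempty := fun y => by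
    refine ⟨b + |y|, ?_⟩
    have h1 : 0 ≤ μ.real (Iic (b + |y|)) := measureReal_nonneg
    have h2 : 0 ≤ min (b + |y| - p) 0 := le_min (by linarith [abs_nonneg y]) le_rfl
    have h3 : b + |y| - b ≤ max (b + |y| - b) 0 := le_max_left _ _
    have h4 := le_abs_self y
    change y ≤ F _
    simp only [F]; linarith
  have hSb : ∀ y, BddBelow {x | y ≤ F x} := fun y => by
    refine ⟨p - |y| - 1, fun x hx => ?_⟩
    by_contra! h
    have := hlow x (by linarith [abs_nonneg y])
    have h4 := neg_abs_le y
    have hx : y ≤ F x := hx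
    linarith
  let Q : ℝ → ℝ := fun y => sInf {x | y ≤ F x}
  have hQle : ∀ y x, y ≤ F x → Q y ≤ x := fun y x h => csInf_le (hSb y) h
  have hFQ : ∀ y, F (Q y) = y := fun y => by
    refine le_antisymm ?_ ((hS y).csInf_mem (hSne y) (hSb y))
    refine le_of_tendsto (f := F) (x := 𝓝[<] (Q y))
      (hcont.continuousAt.tendsto.mono_left nhdsWithin_le_nhds) ?_
    filter_upwards [self_mem_nhdsWithin] with z hz
    by_contra! h
    exact absurd (hQle y z h.le) (not_le.2 hz)
  have hQmono : StrictMono Q := by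
    refine Monotone.strictMono_of_injective (fun y z h => ?_) fun y z h => ?_
    · exact hQle y _ (by rw [hFQ]; exact h)
    · rw [← hFQ y, h, hFQ]
  have hQneg : ∀ y ≤ 0, Q y = p + y := fun y hy => by
    have h1 : Q y ≤ p := hQle y p (by rw [hlow p le_rfl]; linarith)
    have := hlow _ h1
    rw [hFQ] at this
    linarith
  have hpb' : p < b := by
    by_contra! h
    have hbp : b = p := le_antisymm h hpb
    refine hunc 1 one_pos ((countable_singleton p).mono fun x hx => ?_)
    exact le_antisymm (hbp ▸ hb x hx.1) hx.2.1
  refine ⟨Q, F b, hQmono, hFpos b hpb', hQle _ _ le_rfl, hQneg, fun y hy0 hya => ?_, ?_⟩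
  · have hp : p < Q y := by
      by_contra! h
      have := hlow _ h
      rw [hFQ] at this
      linarith
    have hb' : Q y < b := by
      by_contra! h
      have := hmono h
      rw [hFQ] at this
      linarith
    by_contra hq
    obtain ⟨l, ⟨hpl, hlq⟩, hl⟩ := exists_Ioc_subset_of_mem_nhds' (hV.isOpen_compl.mem_nhds hq) hp
    have hG : μ.real (Iic l) = μ.real (Iic (Q y)) := by
      refine le_antisymm (hG hlq.le) ?_
      rw [← Iic_union_Ioc_eq_Iic hlq.le]
      refine (measureReal_union_le _ _).trans ?_
      have : μ (Ioc l (Q y)) = 0 := 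
        measure_mono_null (fun z hz => mt And.left (hl hz)) hsupp
      simp [measureReal_def, this]
    have : F l = F (Q y) := by
      simp only [F, hG, min_eq_right (sub_nonneg.2 hpl), min_eq_right (sub_nonneg.2 hp.le),
        max_eq_right (sub_nonpos.2 hb'.le), max_eq_right (sub_nonpos.2 (hlq.trans hb').le)]
    exact absurd (hQle y l (by rw [this, hFQ])) (not_le.2 hlq)
  · have h0 : Q 0 = p := by simp [hQneg]
    rw [Metric.continuousAt_iff]
    intro ε hε
    have hδ := hFpos (p + ε / 2) (by linarith)
    refine ⟨min ε (F (p + ε / 2)), lt_min hε hδ, fun {y} hy => ?_⟩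
    rw [Real.dist_eq, sub_zero, lt_min_iff] at hy
    rw [Real.dist_eq, h0, abs_lt]
    rw [abs_lt, abs_lt] at hy
    refine ⟨?_, ?_⟩
    · rcases le_total y 0 with h | h
      · rw [hQneg y h]; linarith
      · have := hQmono.monotone h
        linarith
    · have := hQle y (p + ε / 2) hy.2.2.le
      linarith

theorem not_countable_inter_Icc_sInf_perfectKernel {V : Set ℝ}
    (hb : BddBelow V) (hker : (perfectKernel V).Nonempty) {ε : ℝ} (hε : 0 < ε) :
    ¬ (V ∩ Icc (sInf (perfectKernel V)) (sInf (perfectKernel V) + ε)).Countable := by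
  have hsub : perfectKernel V ⊆ V := sUnion_subset fun P hP => hP.2
  have hbk : BddBelow (perfectKernel V) := hb.mono hsub
  set p := sInf (perfectKernel V)
  obtain ⟨x, ⟨P, ⟨hP, hPV⟩, hxP⟩, hx⟩ := exists_lt_of_csInf_lt hker (show p < p + ε by linarith)
  obtain ⟨h1, h2⟩ := hP.closure_nhds_inter x hxP hx isOpen_Iio
  intro hc
  refine h1.not_countable_of_nonempty h2 (hc.mono fun z hz => ?_)
  have hzP : z ∈ P := hP.closed.closure_subset (closure_mono inter_subset_right hz)
  have hz' : z ≤ p + ε :=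
    closure_minimal (inter_subset_left.trans Iio_subset_Iic_self) isClosed_Iic hz
  exact ⟨hPV hzP, csInf_le hbk ⟨P, ⟨hP, hPV⟩, hzP⟩, hz'⟩

/-- Given a countable set `X` of truth values avoiding `w`, a monotone map collapsing the values
above `w` to `1`, strictly monotone below `w`, continuous on `X`, and sending `W` into `V`. -/
theorem exists_monotone_map {V : Set ℝ} (hV : GodelSet V) (hker : (perfectKernel V).Nonempty)
    {X : Set ℝ} (hX : X.Countable) {w : ℝ} (hw0 : 0 < w) (hw1 : w < 1) (hwX : w ∉ X) :
    ∃ g : ℝ → ℝ, Monotone g ∧ g 0 = 0 ∧ g 1 = 1 ∧ (∀ x < w, g x < 1) ∧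
      (∀ x y, y < x → g y < g x ∨ g y = 1) ∧ (∀ x ∈ X, ContinuousAt g x) ∧
      ∀ x ∈ V ∪ Icc (sInf (perfectKernel V)) 1, g x ∈ V := by
  obtain ⟨hcl, hI, h0, h1⟩ := hV
  have hbb : BddBelow V := ⟨0, fun x hx => (hI hx).1⟩
  have hsub : perfectKernel V ⊆ V := sUnion_subset fun P hP => hP.2
  have hunc := fun ε (hε : ε > 0) => not_countable_inter_Icc_sInf_perfectKernel hbb hker hε
  have hpV : sInf (perfectKernel V) ∈ V :=
    hcl.closure_subset (closure_mono hsub (csInf_mem_closure hker (hbb.mono hsub)))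
  set p := sInf (perfectKernel V)
  have hp0 : 0 ≤ p := (hI hpV).1
  obtain ⟨Q, a, hQ, ha, hQa, hQneg, hQV, hQ0⟩ :=
    exists_strictMono_quantile hcl hunc (fun x hx => (hI hx).2)
  have hbad : (⋃ m ∈ X, (fun d => d / (m - p)) '' {y | ¬ ContinuousAt Q y}).Countable :=
    hX.biUnion fun m _ => hQ.monotone.countable_not_continuousAt.image _
  obtain ⟨c, hc, hcbad⟩ : ∃ c ∈ Ioo 0 (min 1 a), c ∉
      ⋃ m ∈ X, (fun d => d / (m - p)) '' {y | ¬ ContinuousAt Q y} := by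
    by_contra! h
    exact (Cardinal.Real.Ioo_countable_iff.not.2 (not_le.2 (lt_min one_pos ha))) (hbad.mono h)
  have hc0 : 0 < c := hc.1
  have hc1 : c < 1 := hc.2.trans_le (min_le_left _ _)
  have hca : c < a := hc.2.trans_le (min_le_right _ _)
  let θ : ℝ → ℝ := fun x => min (x - p) (c * (x - p))
  have hθlow : ∀ x ≤ p, θ x = x - p := fun x hx => min_eq_left (by nlinarith)
  have hθhigh : ∀ x, p ≤ x → θ x = c * (x - p) := fun x hx => min_eq_right (by nlinarith)
  have hθ : StrictMono θ := fun x y h => by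
    have : c * (x - p) < c * (y - p) := by nlinarith
    exact min_lt_min (by linarith) this
  have hθc : Continuous θ := by fun_prop
  let h : ℝ → ℝ := Q ∘ θ
  have hh : StrictMono h := hQ.comp hθ
  have hhlow : ∀ x ≤ p, h x = x := fun x hx => by
    simp only [h, Function.comp, hθlow x hx]
    rw [hQneg _ (by linarith)]; ring
  have hθa : ∀ x ≤ 1, θ x < a := fun x hx =>
    (min_le_right _ _).trans_lt (by nlinarith)
  have hh1 : ∀ x ≤ 1, h x < 1 := fun x hx => (hQ (hθa x hx)).trans_le hQa
  have hhc : ∀ x ∈ X, ContinuousAt h x := fun x hx => by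
    rcases lt_trichotomy x p with hlt | rfl | hgt
    · refine continuousAt_id.congr ?_
      filter_upwards [Iio_mem_nhds hlt] with z hz
      exact (hhlow z (le_of_lt hz)).symm
    · refine ContinuousAt.comp ?_ hθc.continuousAt
      rw [hθlow p le_rfl, sub_self]
      exact hQ0
    · refine ContinuousAt.comp ?_ hθc.continuousAt
      rw [hθhigh x hgt.le]
      by_contra hd
      refine hcbad (mem_biUnion hx ⟨_, hd, ?_⟩)
      field_simp [(sub_pos.2 hgt).ne']
  have hglow : ∀ x < w, (if x < w then h x else 1) = h x := fun x hx => if_pos hx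
  have hghigh : ∀ x, w ≤ x → (if x < w then h x else 1) = 1 := fun x hx => if_neg (not_lt.2 hx)
  refine ⟨fun x => if x < w then h x else 1, fun x y hxy => ?_, ?_, hghigh 1 hw1.le, fun x hx => ?_,
    fun x y hyx => ?_, fun x hx => ?_, fun x hx => ?_⟩
  · rcases lt_or_ge y w with hy | hy
    · simp only [hglow y hy, hglow x (hxy.trans_lt hy)]
      exact hh.monotone hxy
    · simp only [hghigh y hy]
      split_ifs with hx
      · exact (hh1 x (hx.trans hw1).le).le
      · exact le_rfl
  · exact (hglow 0 hw0).trans (hhlow 0 hp0)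
  · simp only [hglow x hx]
    exact hh1 x (hx.trans hw1).le
  · rcases lt_or_ge y w with hy | hy
    · left
      simp only [hglow y hy]
      split_ifs with hx
      · exact hh hyx
      · exact hh1 y (hy.trans hw1).le
    · exact Or.inr (hghigh y hy)
  · rcases lt_or_gt_of_ne (fun h => hwX (h ▸ hx) : x ≠ w) with hlt | hgt
    · refine (hhc x hx).congr ?_
      filter_upwards [Iio_mem_nhds hlt] with z hz
      exact (hglow z hz).symm
    · refine (continuousAt_const (y := (1 : ℝ))).congr ?_
      filter_upwards [Ioi_mem_nhds hgt] with z hz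
      exact (hghigh z (le_of_lt hz)).symm
  · by_cases hxw : x < w
    · simp only [hglow x hxw]
      rcases lt_trichotomy x p with hlt | heq | hgt
      · rw [hhlow x hlt.le]
        exact hx.resolve_right fun h => absurd h.1 (not_le.2 hlt)
      · rw [heq, hhlow p le_rfl]
        exact hpV
      · refine hQV _ ?_ (hθa x (hxw.trans hw1).le)
        rw [hθhigh x hgt.le]
        exact mul_pos hc0 (sub_pos.2 hgt)
    · simpa only [if_neg hxw] using h1

theorem exists_countable_hull {M : Type*} (m₀ : M) (A : List M → Set M)
    (hA : ∀ l, (A l).Countable) :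
    ∃ N : Set M, N.Countable ∧ m₀ ∈ N ∧ ∀ l : List M, (∀ m ∈ l, m ∈ N) → A l ⊆ N := by
  let step : Set M → Set M := fun S => S ∪ ⋃ l ∈ {l : List M | ∀ m ∈ l, m ∈ S}, A l
  let S : ℕ → Set M := fun n => step^[n] {m₀}
  have hS : ∀ n, S (n + 1) = step (S n) := fun n => Function.iterate_succ_apply' step n _
  have hmono : Monotone S := monotone_nat_of_le_succ fun n => by
    rw [hS]; exact subset_union_left
  have hcount : ∀ n, (S n).Countable := fun n => by
    induction n with
    | zero => exact countable_singleton m₀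
    | succ n ih =>
      rw [hS]
      refine ih.union (Countable.biUnion ?_ fun l _ => hA l)
      rw [← range_list_map_coe]
      have := ih.to_subtype
      exact countable_range _
  refine ⟨⋃ n, S n, countable_iUnion hcount, mem_iUnion.2 ⟨0, rfl⟩, fun l hl => ?_⟩
  obtain ⟨n, hn⟩ : ∃ n, ∀ m ∈ l, m ∈ S n := by
    induction l with
    | nil => exact ⟨0, by simp⟩
    | cons x l ih =>
      obtain ⟨n, hn⟩ := ih fun m hm => hl m (List.mem_cons_of_mem _ hm)
      obtain ⟨k, hk⟩ := mem_iUnion.1 (hl x List.mem_cons_self)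
      refine ⟨max n k, fun m hm => ?_⟩
      rcases List.mem_cons.1 hm with rfl | hm
      · exact hmono (le_max_right n k) hk
      · exact hmono (le_max_left n k) (hn m hm)
  refine Subset.trans ?_ (subset_iUnion S (n + 1))
  rw [hS]
  exact (subset_biUnion_of_mem (u := A) (show l ∈ {l : List M | ∀ m ∈ l, m ∈ S n} from hn)).trans
    subset_union_right

theorem exists_countable_iInf_iSup_eq {M : Type*} [Nonempty M] (f : M → ℝ)
    (hb : BddBelow (range f)) (ha : BddAbove (range f)) :
    ∃ A : Set M, A.Countable ∧ ∀ N : Set M, A ⊆ N → N.Nonempty →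
      sInf (range fun m : N => f m) = sInf (range f) ∧
      sSup (range fun m : N => f m) = sSup (range f) := by
  obtain ⟨u, -, hu, humem⟩ := exists_seq_tendsto_sInf (range_nonempty f) hb
  obtain ⟨z, -, hz, hzmem⟩ := exists_seq_tendsto_sSup (range_nonempty f) ha
  choose u' hu' using humem
  choose z' hz' using hzmem
  refine ⟨range u' ∪ range z', (countable_range _).union (countable_range _), fun N hN hne => ?_⟩
  have := hne.to_subtype
  have hsub : (range fun m : N => f m) ⊆ range f := range_subset_iff.2 fun m => mem_range_self _
  constructor
  · refine le_antisymm (ge_of_tendsto' hu fun n => csInf_le (hb.mono hsub) ?_)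
      (csInf_le_csInf hb (range_nonempty _) hsub)
    exact ⟨⟨u' n, hN (Or.inl (mem_range_self n))⟩, hu' n⟩
  · refine le_antisymm (csSup_le_csSup ha (range_nonempty _) hsub)
      (le_of_tendsto' hz fun n => le_csSup (ha.mono hsub) ?_)
    exact ⟨⟨z' n, hN (Or.inr (mem_range_self n))⟩, hz' n⟩

theorem GFormula.self_mem_Subfs {ar : ℕ → ℕ} (φ : GFormula ar) : φ ∈ φ.Subfs := by
  cases φ <;> simp [GFormula.Subfs]

theorem GFormula.finite_Subfs {ar : ℕ → ℕ} (φ : GFormula ar) : φ.Subfs.Finite := by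
  induction φ with
  | bot => exact finite_singleton _
  | atom p ts => exact finite_singleton _
  | conj φ ψ h₁ h₂ => exact (h₁.union h₂).insert _
  | disj φ ψ h₁ h₂ => exact (h₁.union h₂).insert _
  | imp φ ψ h₁ h₂ => exact (h₁.union h₂).insert _
  | all φ h => exact h.insert _
  | ex φ h => exact h.insert _

theorem geval_mem_Icc {ar : ℕ → ℕ} {V : Set ℝ} (hV : V ⊆ Icc 0 1) (v : GValuation ar V)
    (φ : GFormula ar) (e : ℕ → v.M) : geval v e φ ∈ Icc (0 : ℝ) 1 := by
  have := v.ne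
  induction φ generalizing e with
  | bot => simp [geval]
  | atom p ts => exact hV (v.interp_mem _ _)
  | conj φ ψ h₁ h₂ => exact ⟨le_min (h₁ e).1 (h₂ e).1, (min_le_left _ _).trans (h₁ e).2⟩
  | disj φ ψ h₁ h₂ => exact ⟨(h₁ e).1.trans (le_max_left _ _), max_le (h₁ e).2 (h₂ e).2⟩
  | imp φ ψ h₁ h₂ =>
    simp only [geval]
    split_ifs
    · simp
    · exact h₂ e
  | all φ h =>
    obtain ⟨m⟩ := v.ne
    refine ⟨le_csInf (range_nonempty _) ?_, csInf_le_of_le ⟨0, ?_⟩ ⟨m, rfl⟩ (h _).2⟩ <;>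
    · rintro _ ⟨m, rfl⟩
      exact (h _).1
  | ex φ h =>
    obtain ⟨m⟩ := v.ne
    refine ⟨le_csSup_of_le ⟨1, ?_⟩ ⟨m, rfl⟩ (h _).1, csSup_le (range_nonempty _) ?_⟩ <;>
    · rintro _ ⟨m, rfl⟩
      exact (h _).2

theorem geval_congr {ar : ℕ → ℕ} {V : Set ℝ} (v : GValuation ar V) {φ : GFormula ar} {k : ℕ}
    (hφ : φ.VarsBelow k) {e e' : ℕ → v.M} (he : ∀ i < k, e i = e' i) :
    geval v e φ = geval v e' φ := by
  have hcons : ∀ {k : ℕ} {e e' : ℕ → v.M}, (∀ i < k, e i = e' i) → ∀ m : v.M, ∀ i < k + 1,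
      consEnv m e i = consEnv m e' i := by
    rintro k e e' he m (_ | i) hi
    · rfl
    · exact he i (by omega)
  induction φ generalizing k e e' with
  | bot => rfl
  | atom p ts =>
    simp only [geval]
    congr 1
    exact funext fun i => he _ (hφ i)
  | conj φ ψ h₁ h₂ => simp only [geval, h₁ hφ.1 he, h₂ hφ.2 he]
  | disj φ ψ h₁ h₂ => simp only [geval, h₁ hφ.1 he, h₂ hφ.2 he]
  | imp φ ψ h₁ h₂ => simp only [geval, h₁ hφ.1 he, h₂ hφ.2 he]
  | all φ h => simp only [geval, fun m => h hφ (hcons he m)]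
  | ex φ h => simp only [geval, fun m => h hφ (hcons he m)]

/-- The environment listing `l`, followed by the default `m₀`. -/
def listEnv {M : Type} (m₀ : M) (l : List M) : ℕ → M := fun i => l.getD i m₀

theorem consEnv_listEnv {M : Type} (m₀ m : M) (l : List M) :
    consEnv m (listEnv m₀ l) = listEnv m₀ (m :: l) := by
  funext i
  cases i <;> simp [consEnv, listEnv]

theorem coe_listEnv {M : Type} {N : Set M} (m₀ : N) (l : List N) (i : ℕ) :
    Subtype.val (listEnv m₀ l i) = listEnv (m₀ : M) (l.map (↑)) i := by
  simp only [listEnv, List.getD_eq_getElem?_getD, List.getElem?_map]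
  cases l[i]? <;> rfl

/-- Restrict a valuation to a subset of its universe and apply `g` to the truth values. -/
def GValuation.restrictMap {ar : ℕ → ℕ} {V W : Set ℝ} (v : GValuation ar W) (N : Set v.M)
    (hN : N.Nonempty) (g : ℝ → ℝ) (hg : ∀ x ∈ W, g x ∈ V) : GValuation ar V where
  M := N
  ne := hN.to_subtype
  interp p t := g (v.interp p fun i => t i)
  interp_mem _ _ := hg _ (v.interp_mem _ _)

/-- The set of truth values of the formulas in `T` under environments in `N`. -/
def truthValues {ar : ℕ → ℕ} {W : Set ℝ} (v : GValuation ar W) {N : Set v.M} (m₀ : N)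
    (T : Set (GFormula ar)) : Set ℝ :=
  ⋃ B ∈ T, range fun l : List N => geval v (listEnv (m₀ : v.M) (l.map (↑))) B

theorem geval_mem_truthValues {ar : ℕ → ℕ} {W : Set ℝ} (v : GValuation ar W) {N : Set v.M}
    (m₀ : N) {T : Set (GFormula ar)} {B : GFormula ar} (hB : B ∈ T) (l : List N) :
    geval v (listEnv (m₀ : v.M) (l.map (↑))) B ∈ truthValues v m₀ T :=
  mem_biUnion hB (mem_range_self l)

theorem exists_countable_elementary {ar : ℕ → ℕ} {W : Set ℝ} (hW : W ⊆ Icc 0 1)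
    (v : GValuation ar W) (m₀ : v.M) {T : Set (GFormula ar)} (hT : T.Countable) :
    ∃ N : Set v.M, N.Countable ∧ m₀ ∈ N ∧ ∀ l : List N, ∀ B ∈ T,
      sInf (range fun m : N => geval v (consEnv (m : v.M) (listEnv m₀ (l.map (↑)))) B) =
        sInf (range fun m : v.M => geval v (consEnv m (listEnv m₀ (l.map (↑)))) B) ∧
      sSup (range fun m : N => geval v (consEnv (m : v.M) (listEnv m₀ (l.map (↑)))) B) =
        sSup (range fun m : v.M => geval v (consEnv m (listEnv m₀ (l.map (↑)))) B) := by
  have := v.ne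
  choose A hA hAeq using fun (l : List v.M) (B : GFormula ar) =>
    exists_countable_iInf_iSup_eq (fun m : v.M => geval v (consEnv m (listEnv m₀ l)) B)
      ⟨0, forall_mem_range.2 fun m => (geval_mem_Icc hW v _ _).1⟩
      ⟨1, forall_mem_range.2 fun m => (geval_mem_Icc hW v _ _).2⟩
  obtain ⟨N, hN, hm, hcl⟩ := exists_countable_hull m₀ (fun l => ⋃ B ∈ T, A l B)
    fun l => hT.biUnion fun B _ => hA l B
  refine ⟨N, hN, hm, fun l B hB => hAeq _ _ N ?_ ⟨m₀, hm⟩⟩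
  refine (subset_biUnion_of_mem (u := A _) hB).trans (hcl _ fun m h => ?_)
  obtain ⟨m', -, rfl⟩ := List.mem_map.1 h
  exact m'.2

theorem geval_restrictMap {ar : ℕ → ℕ} {V W : Set ℝ} (hW : W ⊆ Icc 0 1) (v : GValuation ar W)
    {N : Set v.M} (m₀ : N) {T : Set (GFormula ar)}
    (hN : ∀ l : List N, ∀ B ∈ T,
      sInf (range fun m : N => geval v (consEnv (m : v.M) (listEnv (m₀ : v.M) (l.map (↑)))) B) =
        sInf (range fun m : v.M => geval v (consEnv m (listEnv (m₀ : v.M) (l.map (↑)))) B) ∧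
      sSup (range fun m : N => geval v (consEnv (m : v.M) (listEnv (m₀ : v.M) (l.map (↑)))) B) =
        sSup (range fun m : v.M => geval v (consEnv m (listEnv (m₀ : v.M) (l.map (↑)))) B))
    {g : ℝ → ℝ} (hg : ∀ x ∈ W, g x ∈ V) (hmono : Monotone g) (hg0 : g 0 = 0) (hg1 : g 1 = 1)
    (hstrict : ∀ x y, y < x → g y < g x ∨ g y = 1)
    (hcont : ∀ x ∈ truthValues v m₀ T, ContinuousAt g x)
    (B : GFormula ar) (hB : B.Subfs ⊆ T) (l : List N) :
    geval (v.restrictMap N ⟨m₀, m₀.2⟩ g hg) (listEnv m₀ l) B =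
      g (geval v (listEnv (m₀ : v.M) (l.map (↑))) B) := by
  have hne : Nonempty N := ⟨m₀⟩
  induction B generalizing l with
  | bot => exact hg0.symm
  | atom p ts =>
    simp only [geval, GValuation.restrictMap]
    congr 2
    exact funext fun i => coe_listEnv m₀ l (ts i)
  | conj φ ψ h₁ h₂ =>
    have h := (subset_insert _ _).trans hB
    simp only [geval, h₁ (subset_union_left.trans h), h₂ (subset_union_right.trans h),
      hmono.map_min]
  | disj φ ψ h₁ h₂ =>
    have h := (subset_insert _ _).trans hB
    simp only [geval, h₁ (subset_union_left.trans h), h₂ (subset_union_right.trans h),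
      hmono.map_max]
  | imp φ ψ h₁ h₂ =>
    have h := (subset_insert _ _).trans hB
    simp only [geval, h₁ (subset_union_left.trans h), h₂ (subset_union_right.trans h)]
    split_ifs with hg' hv hv
    · exact hg1.symm
    · rcases hstrict _ _ (not_le.1 hv) with hlt | heq
      · exact absurd hg' (not_le.2 hlt)
      · exact heq.symm
    · exact absurd (hmono hv) hg'
    · rfl
  | all φ ih =>
    have h := (subset_insert _ _).trans hB
    have hmem := hcont _ (geval_mem_truthValues v m₀ (hB (GFormula.self_mem_Subfs _)) l)
    have hN' := (hN l φ (h φ.self_mem_Subfs)).1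
    simp only [geval] at hmem ⊢
    rw [← hN'] at hmem ⊢
    rw [hmono.map_csInf_of_continuousAt hmem (range_nonempty _)
      ⟨0, forall_mem_range.2 fun m => (geval_mem_Icc hW v _ _).1⟩, ← range_comp]
    refine congrArg (fun f : N → ℝ => sInf (range f)) (funext fun m => ?_)
    refine (congrArg (geval _ · φ) (consEnv_listEnv m₀ m l)).trans ((ih h (m :: l)).trans ?_)
    simp only [Function.comp, consEnv_listEnv]
    rfl
  | ex φ ih =>
    have h := (subset_insert _ _).trans hB
    have hmem := hcont _ (geval_mem_truthValues v m₀ (hB (GFormula.self_mem_Subfs _)) l)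
    have hN' := (hN l φ (h φ.self_mem_Subfs)).2
    simp only [geval] at hmem ⊢
    rw [← hN'] at hmem ⊢
    rw [hmono.map_csSup_of_continuousAt hmem (range_nonempty _)
      ⟨1, forall_mem_range.2 fun m => (geval_mem_Icc hW v _ _).2⟩, ← range_comp]
    refine congrArg (fun f : N → ℝ => sSup (range f)) (funext fun m => ?_)
    refine (congrArg (geval _ · φ) (consEnv_listEnv m₀ m l)).trans ((ih h (m :: l)).trans ?_)
    simp only [Function.comp, consEnv_listEnv]
    rfl

theorem gnorm_eq_one_iff {ar : ℕ → ℕ} {V : Set ℝ} (hV : V ⊆ Icc 0 1) (h0 : (0 : ℝ) ∈ V)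
    (φ : GFormula ar) : GNorm ar V φ = 1 ↔ ∀ v : GValuation ar V, 1 ≤ v.val φ := by
  have : Nonempty (GValuation ar V) := ⟨⟨Unit, ⟨()⟩, fun _ _ => 0, fun _ _ => h0⟩⟩
  have hb : BddBelow (range fun v : GValuation ar V => v.val φ) :=
    ⟨0, forall_mem_range.2 fun v => (geval_mem_Icc hV v _ _).1⟩
  constructor
  · intro h v
    rw [← h]
    exact csInf_le hb (mem_range_self v)
  · intro h
    obtain ⟨v⟩ := this
    refine le_antisymm (csInf_le_of_le hb (mem_range_self v) (geval_mem_Icc hV v _ _).2) ?_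
    exact le_csInf ⟨_, mem_range_self v⟩ (forall_mem_range.2 h)

/-- Regard a valuation into `V` as a valuation into a larger set. -/
def GValuation.ofSubset {ar : ℕ → ℕ} {V W : Set ℝ} (h : V ⊆ W) (v : GValuation ar V) :
    GValuation ar W where
  M := v.M
  ne := v.ne
  interp := v.interp
  interp_mem p t := h (v.interp_mem p t)

theorem geval_ofSubset {ar : ℕ → ℕ} {V W : Set ℝ} (h : V ⊆ W) (v : GValuation ar V)
    (φ : GFormula ar) (e : ℕ → v.M) : geval (v.ofSubset h) e φ = geval v e φ := by
  induction φ generalizing e with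
  | bot => rfl
  | atom p ts => rfl
  | conj φ ψ h₁ h₂ => simp only [geval, h₁, h₂]
  | disj φ ψ h₁ h₂ => simp only [geval, h₁, h₂]
  | imp φ ψ h₁ h₂ => simp only [geval, h₁, h₂]
  | all φ h => exact congrArg (fun f : v.M → ℝ => sInf (range f)) (funext fun m => h _)
  | ex φ h => exact congrArg (fun f : v.M → ℝ => sSup (range f)) (funext fun m => h _)

theorem exists_valuation_val_lt_one {ar : ℕ → ℕ} {V : Set ℝ} (hV : GodelSet V)
    (hker : (perfectKernel V).Nonempty) {φ : GFormula ar} (hφ : φ.IsClosedF)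
    (hW : V ∪ Icc (sInf (perfectKernel V)) 1 ⊆ Icc 0 1)
    (v : GValuation ar (V ∪ Icc (sInf (perfectKernel V)) 1)) (hv : v.val φ < 1) :
    ∃ u : GValuation ar V, u.val φ < 1 := by
  let m₀ : v.M := Classical.choice v.ne
  obtain ⟨N, hN, hm, hNeq⟩ := exists_countable_elementary hW v m₀ φ.finite_Subfs.countable
  have hX : (truthValues v (⟨m₀, hm⟩ : N) φ.Subfs).Countable := by
    have := hN.to_subtype
    exact φ.finite_Subfs.countable.biUnion fun B _ => countable_range _
  have hval0 : 0 ≤ v.val φ := (geval_mem_Icc hW v _ _).1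
  obtain ⟨w, hw, hwX⟩ : ∃ w ∈ Ioo (v.val φ) 1, w ∉ truthValues v (⟨m₀, hm⟩ : N) φ.Subfs := by
    by_contra! h
    exact (Cardinal.Real.Ioo_countable_iff.not.2 (not_le.2 hv)) (hX.mono h)
  obtain ⟨g, hmono, hg0, hg1, hglt, hstrict, hcont, hg⟩ :=
    exists_monotone_map hV hker hX (hval0.trans_lt hw.1) hw.2 hwX
  refine ⟨v.restrictMap N ⟨m₀, hm⟩ g hg, ?_⟩
  have key := geval_restrictMap hW v ⟨m₀, hm⟩ hNeq hg hmono hg0 hg1 hstrict hcont φ Subset.rfl []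
  refine (geval_congr _ hφ (by simp)).trans_lt (key.trans_lt ?_)
  exact hglt _ hw.1

/-- If the perfect kernel `P` of the Gödel set `V` is nonempty and
`W = V ∪ [inf P, 1]`, then `G_V = G_W`. -/
theorem stmt13 (ar : ℕ → ℕ) (V : Set ℝ) (hV : GodelSet V)
    (hker : (perfectKernel V).Nonempty) :
    GLogic ar V = GLogic ar (V ∪ Set.Icc (sInf (perfectKernel V)) 1) := by
  obtain ⟨-, hI, h0, h1⟩ := id hV
  have hW : V ∪ Icc (sInf (perfectKernel V)) 1 ⊆ Icc 0 1 := by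
    refine union_subset hI (Icc_subset_Icc_left ?_)
    exact le_csInf hker fun x ⟨P, hP, hx⟩ => (hI (hP.2 hx)).1
  ext φ
  refine and_congr_right fun hφ => ?_
  rw [gnorm_eq_one_iff hI h0, gnorm_eq_one_iff hW (Or.inl h0)]
  constructor
  · intro h v
    by_contra! hv
    obtain ⟨u, hu⟩ := exists_valuation_val_lt_one hV hker hφ hW v hv
    exact absurd (h u) (not_le.2 hu)
  · intro h v
    exact (h (v.ofSubset subset_union_left)).trans_eq (geval_ofSubset _ v φ _)
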